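/- arXiv:1306.1113 — 11 statements merged into one kernel-verified Lean document; each statement's English description precedes it below -/
import Mathlib

section
/- Let R be a (not necessarily commutative) ring and let X₁, X₂, H, ω ∈ R satisfy ω*H = H*X₂ − X₂*H. Then the intertwining relation (X₂ + ω)*(X₁*X₂ − H) = (X₂*X₁ + ω*X₁ − H)*X₂ holds; i.e., setting L = X₁*X₂ − H, L₁ = X₂*X₁ + ω*X₁ − H, M = X₂, M₁ = X₂ + ω, one has M₁*L = L₁*M. -/
theorem stmt_0 {R : Type*} [Ring R] (X₁ X₂ H ω : R)
    (h : ω * H = H * X₂ - X₂ * H) :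
    (X₂ + ω) * (X₁ * X₂ - H) = (X₂ * X₁ + ω * X₁ - H) * X₂ := by
  simp only [add_mul, mul_sub, sub_mul, h, mul_assoc]
  abel
end

section
/- Let R be a (not necessarily commutative) ring and let L, L₁, M, M₁, X₁ ∈ R satisfy the intertwining relation M₁*L = L₁*M together with the equation X₁*M − M*X₁ − (M₁ − M)*X₁ = L − L₁. Set X₂ := M, ω := M₁ − M and H := X₁*M − L. Then H*X₂ − X₂*H = ω*H and L₁ = X₂*X₁ + ω*X₁ − H; in particular L and L₁ are connected by an Intertwining Laplace Transformation. -/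
theorem stmt_1 {R : Type*} [Ring R] (L L₁ M M₁ X₁ : R)
    (hint : M₁ * L = L₁ * M)
    (hX₁ : X₁ * M - M * X₁ - (M₁ - M) * X₁ = L - L₁) :
    (X₁ * M - L) * M - M * (X₁ * M - L) = (M₁ - M) * (X₁ * M - L) ∧
    L₁ = M * X₁ + (M₁ - M) * X₁ - (X₁ * M - L) := by
  have hL₁ : L₁ = M * X₁ + (M₁ - M) * X₁ - (X₁ * M - L) := by
    rw [← sub_sub_self L L₁, ← hX₁]
    abel
  refine ⟨?_, hL₁⟩
  have hM : M₁ * L = (M * X₁ + (M₁ - M) * X₁ - (X₁ * M - L)) * M := by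
    rw [hint, ← hL₁]
  rw [sub_mul M₁ M (X₁ * M - L), mul_sub M₁, hM]
  noncomm_ring
end

section
/- Let R be a (not necessarily commutative) ring and let H, X₂, κ, ρ, α ∈ R satisfy [H,X₂] = κ*H + ρ*X₂ and [X₂,α] + κ*α = ρ. Then [H + α*X₂, X₂] = κ*(H + α*X₂). -/
theorem stmt_2 {R : Type*} [Ring R] (H X₂ κ ρ α : R)
    (h1 : H * X₂ - X₂ * H = κ * H + ρ * X₂)
    (h2 : (X₂ * α - α * X₂) + κ * α = ρ) :
    (H + α * X₂) * X₂ - X₂ * (H + α * X₂) = κ * (H + α * X₂) := by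
  calc (H + α * X₂) * X₂ - X₂ * (H + α * X₂)
      = (H * X₂ - X₂ * H) - (X₂ * α - α * X₂) * X₂ := by noncomm_ring
    _ = κ * (H + α * X₂) := by
      rw [h1, ← h2]
      noncomm_ring
end

section
/- Let R be a (not necessarily commutative) ring and let X₁, X₂, H, κ, ρ, α ∈ R satisfy [H,X₂] = κ*H + ρ*X₂ and [X₂,α] + κ*α = ρ. Then [H + α*X₂, X₂] = κ*(H + α*X₂), and the operator obtained by the Intertwining Laplace Transformation from the representation L = (X₁ + α)*X₂ − (H + α*X₂) coincides with the Dini-transformed operator: X₂*(X₁ + α) + κ*(X₁ + α) − (H + α*X₂) = X₂*X₁ + κ*X₁ − H + ρ. -/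
theorem stmt_3 {R : Type*} [Ring R] (X₁ X₂ H κ ρ α : R)
    (h1 : H * X₂ - X₂ * H = κ * H + ρ * X₂)
    (h2 : (X₂ * α - α * X₂) + κ * α = ρ) :
    (H + α * X₂) * X₂ - X₂ * (H + α * X₂) = κ * (H + α * X₂) ∧
    X₂ * (X₁ + α) + κ * (X₁ + α) - (H + α * X₂) = X₂ * X₁ + κ * X₁ - H + ρ := by
  subst h2
  constructor
  · calc (H + α * X₂) * X₂ - X₂ * (H + α * X₂)
        = (H * X₂ - X₂ * H) + (α * X₂ - X₂ * α) * X₂ := by noncomm_ring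
      _ = κ * (H + α * X₂) := by rw [h1]; noncomm_ring
  · noncomm_ring
end

section
/- Let R be a (not necessarily commutative) ring, let D, H, α, ψ ∈ R, and let μ, ρ be units of R. Assume H*(D + α) = (D + α + ψ)*H, α*ρ = ρ*α, μ*α = α*μ, μ*ψ = ψ*μ, and that μ commutes with the commutator [D,μ] = D*μ − μ*D. Then (μ*H*ρ)*(D + α + ρ⁻¹*(D*ρ − ρ*D)) = (D − μ⁻¹*(D*μ − μ*D) + α + ψ)*(μ*H*ρ). -/
theorem stmt_5 {R : Type*} [Ring R] (D H α ψ : R) (μ ρ : Rˣ)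
    (h : H * (D + α) = (D + α + ψ) * H)
    (hαρ : α * (ρ : R) = (ρ : R) * α)
    (hμα : (μ : R) * α = α * (μ : R))
    (hμψ : (μ : R) * ψ = ψ * (μ : R))
    (hμcomm : (μ : R) * (D * (μ : R) - (μ : R) * D)
      = (D * (μ : R) - (μ : R) * D) * (μ : R)) :
    ((μ : R) * H * (ρ : R)) * (D + α + ((ρ⁻¹ : Rˣ) : R) * (D * (ρ : R) - (ρ : R) * D))
      = (D - ((μ⁻¹ : Rˣ) : R) * (D * (μ : R) - (μ : R) * D) + α + ψ)
        * ((μ : R) * H * (ρ : R)) := by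
  have hρ : (ρ : R) * (D + α + ((ρ⁻¹ : Rˣ) : R) * (D * (ρ : R) - (ρ : R) * D))
      = (D + α) * (ρ : R) := by
    rw [mul_add, Units.mul_inv_cancel_left, mul_add, add_mul, hαρ]
    abel
  have hμ : (D - ((μ⁻¹ : Rˣ) : R) * (D * (μ : R) - (μ : R) * D) + α + ψ) * (μ : R)
      = (μ : R) * (D + α + ψ) := by
    rw [add_mul, add_mul, sub_mul, mul_assoc _ _ (μ : R), ← hμcomm,
      Units.inv_mul_cancel_left, mul_add, mul_add, hμα, hμψ]
    abel
  calc _ = (μ : R) * (H * (D + α)) * (ρ : R) := by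
        rw [mul_assoc _ (ρ : R), hρ]
        simp only [mul_assoc]
    _ = (μ : R) * (D + α + ψ) * H * (ρ : R) := by
        rw [h]
        simp only [mul_assoc]
    _ = _ := by
        rw [← hμ]
        simp only [mul_assoc]
end

section
/- Let R be a (not necessarily commutative) ring, let X₁, X₂, ψ ∈ R, and let H be a unit of R such that H*X₂ − X₂*H = ψ*H. Set L := X₁*X₂ − H and σ := H*X₁*H⁻¹ − X₁. Then X₁*(X₂ + ψ) + σ*(X₂ + ψ) − H = H*L*H⁻¹. -/
theorem stmt_6 {R : Type*} [Ring R] (X₁ X₂ ψ : R) (H : Rˣ)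
    (h : (H : R) * X₂ - X₂ * (H : R) = ψ * (H : R)) :
    X₁ * (X₂ + ψ) + ((H : R) * X₁ * ((H⁻¹ : Rˣ) : R) - X₁) * (X₂ + ψ) - (H : R)
      = (H : R) * (X₁ * X₂ - (H : R)) * ((H⁻¹ : Rˣ) : R) := by
  have conj : X₂ + ψ = (H : R) * X₂ * ((H⁻¹ : Rˣ) : R) := by
    rw [Units.eq_mul_inv_iff_mul_eq, add_mul, ← h, add_sub_cancel]
  rw [← add_mul, add_sub_cancel, conj]
  simp only [mul_sub, sub_mul, mul_assoc, Units.inv_mul_cancel_left, Units.mul_inv, mul_one]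
end

section
/- Let R be a (not necessarily commutative) ring, let X₁, X₂, ψ ∈ R, and let H be a unit of R such that H*X₂ − X₂*H = ψ*H. Set L := X₁*X₂ − H, L₁ := (X₂ + ψ)*X₁ − H, σ := H*X₁*H⁻¹ − X₁, N := H⁻¹*(X₁ + σ) and N₁ := H⁻¹*X₁. Then N*L₁ = L*N₁; i.e., the formal inverse intertwining relation for the Intertwining Laplace Transformation holds. -/
theorem stmt_7 {R : Type*} [Ring R] (X₁ X₂ ψ : R) (H : Rˣ)
    (h : (H : R) * X₂ - X₂ * (H : R) = ψ * (H : R)) :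
    (((H⁻¹ : Rˣ) : R) * (X₁ + ((H : R) * X₁ * ((H⁻¹ : Rˣ) : R) - X₁)))
        * ((X₂ + ψ) * X₁ - (H : R))
      = (X₁ * X₂ - (H : R)) * (((H⁻¹ : Rˣ) : R) * X₁) := by
  have conj_X₂ : X₂ + ψ = (H : R) * X₂ * ((H⁻¹ : Rˣ) : R) := by
    rw [Units.eq_mul_inv_iff_mul_eq, add_mul, ← h, add_sub_cancel]
  rw [conj_X₂, add_sub_cancel]
  simp [mul_sub, sub_mul, mul_assoc]
end

section
/- Let R be a (not necessarily commutative) ring, V a left R-module, and X₁, X₂, H, ψ ∈ R with H*X₂ − X₂*H = ψ*H. If u, v ∈ V satisfy X₂ • u = v and H • u = X₁ • v, then (X₂*X₁ + ψ*X₁ − H) • v = 0. -/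
theorem stmt_9 {R : Type*} [Ring R] {V : Type*} [AddCommGroup V] [Module R V]
    (X₁ X₂ H ψ : R) (h : H * X₂ - X₂ * H = ψ * H)
    (u v : V) (h1 : X₂ • u = v) (h2 : H • u = X₁ • v) :
    (X₂ * X₁ + ψ * X₁ - H) • v = 0 := by
  have hH : H * X₂ = X₂ * H + ψ * H := by rw [← h]; abel
  rw [sub_smul, add_smul, mul_smul, mul_smul, ← h2, ← mul_smul, ← mul_smul, ← add_smul, ← hH,
    mul_smul, h1, sub_self]
end

section
/- Let u : ℝ → ℝ be differentiable, let ω : ℝ → ℝ be such that ω and deriv ω are differentiable, ω x ≠ 0 for all x, and deriv (deriv ω) x = u x * ω x for all x. Set v := fun x => deriv ω x / ω x and ũ := fun x => u x − 2 * deriv v x. Let y : ℝ → ℝ be such that y and deriv y are differentiable and deriv (deriv y) x = u x * y x for all x, and set z := fun x => −deriv y x + v x * y x. Then z and deriv z are differentiable and deriv (deriv z) x = ũ x * z x for all x; i.e., the Darboux transformation z = Ay maps solutions of −y'' + uy = 0 to solutions of −z'' + ũz = 0 with ũ = u − 2(log ω)_{xx}. -/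
/-- The logarithmic derivative of a nonvanishing solution of `-ω'' + u ω = 0` satisfies the
Riccati equation `v' = u - v ^ 2`. -/
theorem hasDerivAt_logDeriv_of_schrodinger {u ω : ℝ → ℝ} {x : ℝ}
    (hω : DifferentiableAt ℝ ω x) (hω' : DifferentiableAt ℝ (deriv ω) x)
    (hne : ω x ≠ 0) (hsol : deriv (deriv ω) x = u x * ω x) :
    HasDerivAt (fun t => deriv ω t / ω t) (u x - (deriv ω x / ω x) ^ 2) x := by
  refine HasDerivAt.congr_deriv (hω'.hasDerivAt.fun_div hω.hasDerivAt hne) ?_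
  rw [hsol]
  field_simp

theorem stmt_16 (u : ℝ → ℝ) (hu : Differentiable ℝ u)
    (ω : ℝ → ℝ) (hω : Differentiable ℝ ω) (hω' : Differentiable ℝ (deriv ω))
    (hne : ∀ x, ω x ≠ 0) (hωsol : ∀ x, deriv (deriv ω) x = u x * ω x)
    (v : ℝ → ℝ) (hv : v = fun x => deriv ω x / ω x)
    (util : ℝ → ℝ) (hutil : util = fun x => u x - 2 * deriv v x)
    (y : ℝ → ℝ) (hy : Differentiable ℝ y) (hy' : Differentiable ℝ (deriv y))
    (hysol : ∀ x, deriv (deriv y) x = u x * y x)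
    (z : ℝ → ℝ) (hz : z = fun x => -deriv y x + v x * y x) :
    Differentiable ℝ z ∧ Differentiable ℝ (deriv z) ∧
      ∀ x, deriv (deriv z) x = util x * z x := by
  have hvd : ∀ x, HasDerivAt v (u x - v x ^ 2) x := fun x => by
    rw [hv]
    exact hasDerivAt_logDeriv_of_schrodinger (hω x) (hω' x) (hne x) (hωsol x)
  have hzd : ∀ x, HasDerivAt z (-(v x * z x)) x := fun x => by
    rw [hz]
    refine HasDerivAt.congr_deriv
      ((hy' x).hasDerivAt.fun_neg.fun_add ((hvd x).fun_mul (hy x).hasDerivAt)) ?_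
    rw [hysol]
    ring
  have hz' : deriv z = fun x => -(v x * z x) := funext fun x => (hzd x).deriv
  have hzdd : ∀ x, HasDerivAt (deriv z) (util x * z x) x := fun x => by
    rw [hz']
    refine HasDerivAt.congr_deriv ((hvd x).fun_mul (hzd x)).fun_neg ?_
    simp only [hutil, (hvd x).deriv]
    ring
  exact ⟨fun x => (hzd x).differentiableAt, fun x => (hzdd x).differentiableAt,
    fun x => (hzdd x).deriv⟩
end

section
/- Let a, b, c : ℝ × ℝ → ℝ with a differentiable, let u₁ : ℝ × ℝ → ℝ be C² with u₁ p ≠ 0 for all p and ∂₁(∂₂u₁) p + a p * ∂₁u₁ p + b p * ∂₂u₁ p + c p * u₁ p = 0 for all p, and let u : ℝ × ℝ → ℝ be C². Set (Mu) q := ∂₁u q − (∂₁u₁ q / u₁ q) * u q and α p := b p + ∂₁u₁ p / u₁ p. Then for every p: (∂₁(∂₂u) p + a p * ∂₁u p + b p * ∂₂u p + c p * u p) − (∂₂(Mu) p + a p * (Mu) p) = α p * (∂₂u p − (∂₂u₁ p / u₁ p) * u p); i.e., reducing Lu by (D_y + a)Mu leaves the first-order operator α(D_y − (u₁)_y/u₁),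 which is the involutive form of the system {Lu = 0, Mu = 0} underlying the first-order Darboux transformation of L with M = D_x − (u₁)_x/u₁. -/
/-- Partial derivative with respect to the first coordinate. -/
noncomputable def pd1 (f : ℝ × ℝ → ℝ) (p : ℝ × ℝ) : ℝ := fderiv ℝ f p (1, 0)

/-- Partial derivative with respect to the second coordinate. -/
noncomputable def pd2 (f : ℝ × ℝ → ℝ) (p : ℝ × ℝ) : ℝ := fderiv ℝ f p (0, 1)

theorem ContDiff.differentiable_fderiv_apply {f : ℝ × ℝ → ℝ} (hf : ContDiff ℝ 2 f) (v : ℝ × ℝ) :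
    Differentiable ℝ fun q => fderiv ℝ f q v :=
  ((hf.fderiv_right (m := 1) (by norm_num)).differentiable one_ne_zero).clm_apply
    (differentiable_const v)

/-- Mixed partial derivatives of a `C²` function commute. -/
theorem pd2_pd1_eq_pd1_pd2 {f : ℝ × ℝ → ℝ} (hf : ContDiff ℝ 2 f) (p : ℝ × ℝ) :
    pd2 (pd1 f) p = pd1 (pd2 f) p := by
  have hd : DifferentiableAt ℝ (fderiv ℝ f) p :=
    (hf.fderiv_right (m := 1) (by norm_num)).differentiable one_ne_zero p
  have hs : IsSymmSndFDerivAt ℝ f p := hf.contDiffAt.isSymmSndFDerivAt (by simp)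
  have key (v w : ℝ × ℝ) :
      fderiv ℝ (fun q => fderiv ℝ f q v) p w = fderiv ℝ (fderiv ℝ f) p w v := by
    rw [fderiv_clm_apply hd (differentiableAt_const v)]
    simp
  exact (key _ _).trans ((hs _ _).trans (key _ _).symm)

theorem pd2_sub {f g : ℝ × ℝ → ℝ} {p : ℝ × ℝ} (hf : DifferentiableAt ℝ f p)
    (hg : DifferentiableAt ℝ g p) : pd2 (fun q => f q - g q) p = pd2 f p - pd2 g p := by
  simp only [pd2, fderiv_fun_sub hf hg, sub_apply]

theorem pd2_mul {f g : ℝ × ℝ → ℝ} {p : ℝ × ℝ} (hf : DifferentiableAt ℝ f p)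
    (hg : DifferentiableAt ℝ g p) :
    pd2 (fun q => f q * g q) p = f p * pd2 g p + g p * pd2 f p := by
  simp [pd2, fderiv_fun_mul hf hg]

theorem DifferentiableAt.div_of_ne_zero {f g : ℝ × ℝ → ℝ} {p : ℝ × ℝ}
    (hf : DifferentiableAt ℝ f p) (hg : DifferentiableAt ℝ g p) (hp : g p ≠ 0) :
    DifferentiableAt ℝ (fun q => f q / g q) p := by
  simpa only [div_eq_mul_inv] using hf.fun_mul (hg.fun_inv hp)

/-- The quotient rule, in division-free form. -/
theorem mul_pd2_div {f g : ℝ × ℝ → ℝ} {p : ℝ × ℝ} (hf : DifferentiableAt ℝ f p)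
    (hg : DifferentiableAt ℝ g p) (hne : ∀ q, g q ≠ 0) :
    g p * pd2 (fun q => f q / g q) p = pd2 f p - f p / g p * pd2 g p := by
  have h := pd2_mul (hf.div_of_ne_zero hg (hne p)) hg
  simp only [div_mul_cancel₀ _ (hne _)] at h
  change pd2 f p = _ at h
  linear_combination -h

theorem stmt_17 (a b c : ℝ × ℝ → ℝ) (ha : Differentiable ℝ a)
    (u₁ : ℝ × ℝ → ℝ) (hu₁ : ContDiff ℝ 2 u₁) (hne : ∀ p, u₁ p ≠ 0)
    (hsol : ∀ p, pd1 (pd2 u₁) p + a p * pd1 u₁ p + b p * pd2 u₁ p + c p * u₁ p = 0)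
    (u : ℝ × ℝ → ℝ) (hu : ContDiff ℝ 2 u)
    (Mu : ℝ × ℝ → ℝ) (hMu : Mu = fun q => pd1 u q - (pd1 u₁ q / u₁ q) * u q)
    (α : ℝ × ℝ → ℝ) (hα : α = fun p => b p + pd1 u₁ p / u₁ p) :
    ∀ p : ℝ × ℝ,
      (pd1 (pd2 u) p + a p * pd1 u p + b p * pd2 u p + c p * u p)
          - (pd2 Mu p + a p * Mu p)
        = α p * (pd2 u p - (pd2 u₁ p / u₁ p) * u p) := by
  intro p
  subst hMu hα
  have hu₁d : DifferentiableAt ℝ u₁ p := hu₁.differentiable two_ne_zero p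
  have hud : DifferentiableAt ℝ u p := hu.differentiable two_ne_zero p
  have hu₁x : DifferentiableAt ℝ (pd1 u₁) p := hu₁.differentiable_fderiv_apply (1, 0) p
  have hux : DifferentiableAt ℝ (pd1 u) p := hu.differentiable_fderiv_apply (1, 0) p
  have hquot := hu₁x.div_of_ne_zero hu₁d (hne p)
  have hdiv := mul_pd2_div hu₁x hu₁d hne
  rw [pd2_pd1_eq_pd1_pd2 hu₁] at hdiv
  rw [pd2_sub hux (hquot.fun_mul hud), pd2_mul hquot hud, pd2_pd1_eq_pd1_pd2 hu]
  have hp := hne p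
  have hs := hsol p
  apply mul_left_cancel₀ hp
  field_simp at hdiv ⊢
  linear_combination u p * hdiv + u p * u₁ p * hs
end

section
/- Let a, b, c : ℝ × ℝ → ℝ and let z₁ : ℝ × ℝ → ℝ be C² with z₁ p ≠ 0 for all p and ∂₁(∂₁z₁) p + a p * ∂₁z₁ p + b p * ∂₂z₁ p + c p * z₁ p = 0 for all p. Set r := fun q => −∂₁z₁ q / z₁ q. Then for every p: b p * ∂₂z₁ p + (c p − ∂₁r p + (r p)^2 − a p * r p) * z₁ p = 0; i.e., in the decomposition L = QX₂ + R of the parabolic operator with X₂ = D_x + r, the remainder operator R = bD_y + (c − r_x + r² − ar) annihilates z₁. -/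
lemma pd1_mul {f g : ℝ × ℝ → ℝ} {p : ℝ × ℝ} (hf : DifferentiableAt ℝ f p)
    (hg : DifferentiableAt ℝ g p) :
    pd1 (fun q => f q * g q) p = pd1 f p * g p + f p * pd1 g p := by
  simp only [pd1, fderiv_fun_mul hf hg, add_apply, smul_apply, smul_eq_mul]
  ring

lemma pd1_neg (f : ℝ × ℝ → ℝ) (p : ℝ × ℝ) : pd1 (fun q => -f q) p = -pd1 f p := by
  simp [pd1, fderiv_fun_neg]

lemma ContDiff.differentiable_pd1 {f : ℝ × ℝ → ℝ} (hf : ContDiff ℝ 2 f) :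
    Differentiable ℝ (pd1 f) :=
  ((hf.fderiv_right (m := 1) (by norm_num)).clm_apply contDiff_const).differentiable (by norm_num)

theorem stmt_19 (a b c : ℝ × ℝ → ℝ)
    (z₁ : ℝ × ℝ → ℝ) (hz₁ : ContDiff ℝ 2 z₁) (hne : ∀ p, z₁ p ≠ 0)
    (hsol : ∀ p, pd1 (pd1 z₁) p + a p * pd1 z₁ p + b p * pd2 z₁ p + c p * z₁ p = 0)
    (r : ℝ × ℝ → ℝ) (hr : r = fun q => -pd1 z₁ q / z₁ q) :
    ∀ p : ℝ × ℝ,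
      b p * pd2 z₁ p + (c p - pd1 r p + (r p) ^ 2 - a p * r p) * z₁ p = 0 := by
  intro p
  have hz : Differentiable ℝ z₁ := hz₁.differentiable (by norm_num)
  have hrd : Differentiable ℝ r := by
    rw [hr]
    simp only [div_eq_mul_inv]
    exact hz₁.differentiable_pd1.neg.mul (hz.inv hne)
  have hrz : pd1 z₁ = fun q => -(r q * z₁ q) := by
    funext q
    rw [hr]
    field_simp [hne q]
  have hxx : pd1 (pd1 z₁) p = -(pd1 r p * z₁ p + r p * pd1 z₁ p) := by
    conv_lhs => rw [hrz]
    rw [pd1_neg, pd1_mul (hrd p) (hz p)]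
  have hx : pd1 z₁ p = -(r p * z₁ p) := congrFun hrz p
  have h := hsol p
  rw [hxx, hx] at h
  linear_combination h
end
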